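/- arXiv:2602.07863 — 11 statements merged into one kernel-verified Lean document; each statement's English description precedes it below -/
import Mathlib

section
/- Let n ≥ 3 and for each 1 ≤ i ≤ n-1 let Λ_i be the Tits matrix in GL_{n-1}(ℂ). Let U ⊆ ℂ^{n-1} be a linear subspace invariant under Λ_i for every 1 ≤ i ≤ n-1 (i.e. Λ_i(U) ⊆ U). If there exists an index 1 ≤ i ≤ n-1 such that the standard basis vector e_i belongs to U, then U = ℂ^{n-1}. -/
/-- The Tits matrix `Λ_i` in `GL_{n-1}(ℂ)` (generator index `i` 0-based): it agrees
with the identity matrix in every row except row `i`, whose entries are `-1` in column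
`i`, `1` in each column `j` with `|i - j| = 1`, and `2` in each column `j` with
`|i - j| >= 2`. -/
noncomputable def titsMat (n : ℕ) (i : Fin (n - 1)) :
    Matrix (Fin (n - 1)) (Fin (n - 1)) ℂ :=
  Matrix.of fun a b =>
    if a = i then
      (if b = i then -1
       else if (a : ℕ) + 1 = (b : ℕ) ∨ (b : ℕ) + 1 = (a : ℕ) then 1
       else 2)
    else if a = b then 1 else 0

/-- For `i ≠ j`, the matrix `Λ_i` moves `e_j` by a nonzero multiple of `e_i`. -/
theorem exists_titsMat_mulVec_single (n : ℕ) {i j : Fin (n - 1)} (hij : j ≠ i) :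
    ∃ c : ℂ, c ≠ 0 ∧
      (titsMat n i).mulVec (Pi.single j 1) - Pi.single j 1 = c • Pi.single i 1 := by
  refine ⟨titsMat n i i j, ?_, ?_⟩
  · simp only [titsMat, Matrix.of_apply, if_true, if_neg hij]
    split_ifs <;> norm_num
  · ext a
    rw [Matrix.mulVec_single_one]
    by_cases ha : a = i
    · subst ha
      simp [hij.symm]
    · simp [titsMat, Pi.single_apply, ha]

/-- Let `n >= 3` and let the Tits matrices act on `ℂ^(n-1)`. If a
subspace `U` is invariant under every Tits matrix and contains some standard basis
vector `e_i`, then `U` is all of `ℂ^(n-1)`. -/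
theorem tits_invariant_subspace_eq_top (n : ℕ) (hn : 3 ≤ n)
    (U : Submodule ℂ (Fin (n - 1) → ℂ))
    (hU : ∀ i : Fin (n - 1), ∀ u ∈ U, (titsMat n i).mulVec u ∈ U)
    (h : ∃ i : Fin (n - 1), (Pi.single i 1 : Fin (n - 1) → ℂ) ∈ U) :
    U = ⊤ := by
  obtain ⟨j, hj⟩ := h
  have hmem (i : Fin (n - 1)) : (Pi.single i 1 : Fin (n - 1) → ℂ) ∈ U := by
    by_cases hij : j = i
    · exact hij ▸ hj
    · obtain ⟨c, hc, hc'⟩ := exists_titsMat_mulVec_single n hij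
      exact (U.smul_mem_iff hc).1 (hc' ▸ U.sub_mem (hU i _ hj) hj)
  rw [eq_top_iff, ← (Pi.basisFun ℂ (Fin (n - 1))).span_eq, Submodule.span_le]
  rintro _ ⟨i, rfl⟩
  simpa using hmem i
end

section
/- For every positive integer n, the n × n complex matrix A_n whose entries are given by (A_n)_{ii} = -2 for all i, (A_n)_{ij} = 1 whenever |i-j| = 1, and (A_n)_{ij} = 2 whenever |i-j| ≥ 2, is invertible. -/
/-- The `n x n` complex matrix `A_n` with diagonal entries `-2`, entries `1` on the
first super- and sub-diagonals, and entries `2` everywhere else. -/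
noncomputable def matA (n : ℕ) : Matrix (Fin n) (Fin n) ℂ :=
  Matrix.of fun i j =>
    if i = j then -2
    else if (i : ℕ) + 1 = (j : ℕ) ∨ (j : ℕ) + 1 = (i : ℕ) then 1
    else 2

/-- The adjacency matrix of the path on `n` vertices. -/
def pathMatrix (n : ℕ) : Matrix (Fin n) (Fin n) ℝ :=
  Matrix.of fun i j => if (i : ℕ) + 1 = (j : ℕ) ∨ (j : ℕ) + 1 = (i : ℕ) then 1 else 0

/-- The real matrix whose complexification is `matA n`. -/
def realMatA (n : ℕ) : Matrix (Fin n) (Fin n) ℝ :=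
  Matrix.of fun i j => 2 - (if i = j then 4 else 0) - pathMatrix n i j

lemma realMatA_map (n : ℕ) : (realMatA n).map Complex.ofRealHom = matA n := by
  ext i j
  by_cases hij : i = j
  · subst hij
    simp [realMatA, pathMatrix, matA]
    norm_num
  · simp only [realMatA, pathMatrix, matA, Matrix.map_apply, Matrix.of_apply, if_neg hij]
    split_ifs <;> norm_num

lemma pathMatrix_nonneg (n : ℕ) (i j : Fin n) : 0 ≤ pathMatrix n i j := by
  simp only [pathMatrix, Matrix.of_apply]
  split_ifs <;> norm_num

lemma pathMatrix_comm (n : ℕ) (i j : Fin n) : pathMatrix n i j = pathMatrix n j i := by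
  simp only [pathMatrix, Matrix.of_apply, or_comm]

lemma sum_pathMatrix_le (n : ℕ) (i : Fin n) : ∑ j, pathMatrix n i j ≤ 2 := by
  simp only [pathMatrix, Matrix.of_apply, Finset.sum_boole]
  have h₁ : (Finset.univ.filter fun j : Fin n => (i : ℕ) + 1 = j).card ≤ 1 :=
    Finset.card_le_one.2 fun a ha b hb => by
      simp only [Finset.mem_filter, Finset.mem_univ, true_and] at ha hb
      exact Fin.ext (by omega)
  have h₂ : (Finset.univ.filter fun j : Fin n => (j : ℕ) + 1 = i).card ≤ 1 :=
    Finset.card_le_one.2 fun a ha b hb => by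
      simp only [Finset.mem_filter, Finset.mem_univ, true_and] at ha hb
      exact Fin.ext (by omega)
  rw [Finset.filter_or]
  exact_mod_cast (Finset.card_union_le _ _).trans (Nat.add_le_add h₁ h₂)

lemma neg_le_sum_pathMatrix_mul (n : ℕ) (w : Fin n → ℝ) :
    -(2 * ∑ i, w i ^ 2) ≤ ∑ i, ∑ j, pathMatrix n i j * (w i * w j) := by
  have hrow : ∑ i, ∑ j, pathMatrix n i j * w i ^ 2 ≤ 2 * ∑ i, w i ^ 2 := by
    rw [Finset.mul_sum]
    refine Finset.sum_le_sum fun i _ => ?_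
    rw [← Finset.sum_mul]
    exact mul_le_mul_of_nonneg_right (sum_pathMatrix_le n i) (sq_nonneg _)
  have hcol : ∑ i, ∑ j, pathMatrix n i j * w j ^ 2 = ∑ i, ∑ j, pathMatrix n i j * w i ^ 2 := by
    rw [Finset.sum_comm]
    simp only [pathMatrix_comm n]
  have hsq : 0 ≤ ∑ i, ∑ j, pathMatrix n i j * (w i + w j) ^ 2 :=
    Finset.sum_nonneg fun i _ => Finset.sum_nonneg fun j _ =>
      mul_nonneg (pathMatrix_nonneg n i j) (sq_nonneg _)
  have hexp : ∑ i, ∑ j, pathMatrix n i j * (w i + w j) ^ 2 =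
      ∑ i, ∑ j, pathMatrix n i j * w i ^ 2 + ∑ i, ∑ j, pathMatrix n i j * w j ^ 2 +
        2 * ∑ i, ∑ j, pathMatrix n i j * (w i * w j) := by
    simp only [Finset.mul_sum, ← Finset.sum_add_distrib]
    exact Finset.sum_congr rfl fun i _ => Finset.sum_congr rfl fun j _ => by ring
  linarith

lemma sum_realMatA_mul (n : ℕ) (w : Fin n → ℝ) :
    ∑ i, ∑ j, realMatA n i j * (w i * w j) =
      2 * (∑ i, w i) ^ 2 - 4 * ∑ i, w i ^ 2 - ∑ i, ∑ j, pathMatrix n i j * (w i * w j) := by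
  simp only [realMatA, Matrix.of_apply, sub_mul, Finset.sum_sub_distrib, ite_mul, zero_mul,
    Finset.sum_ite_eq, Finset.mem_univ, if_true, ← Finset.mul_sum, ← Finset.sum_mul, sq]

lemma realMatA_comm (n : ℕ) (i j : Fin n) : realMatA n i j = realMatA n j i := by
  simp only [realMatA, Matrix.of_apply, pathMatrix_comm n i j, eq_comm]

lemma sum_realMatA_pos {n : ℕ} (hn : 4 ≤ n) : 0 < ∑ i, ∑ j, realMatA n i j := by
  have h := sum_realMatA_mul n fun _ => 1
  have hP : ∑ i, ∑ j, pathMatrix n i j ≤ ∑ _i : Fin n, (2 : ℝ) :=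
    Finset.sum_le_sum fun i _ => sum_pathMatrix_le n i
  simp only [mul_one, one_pow, Finset.sum_const, Finset.card_univ, Fintype.card_fin,
    nsmul_eq_mul] at h hP
  have hn' : (4 : ℝ) ≤ n := by exact_mod_cast hn
  nlinarith

lemma realMatA_det_ne_zero {n : ℕ} (hn : 4 ≤ n) : (realMatA n).det ≠ 0 := by
  intro hdet
  obtain ⟨v, hv, hAv⟩ := Matrix.exists_mulVec_eq_zero_iff.2 hdet
  have hrow (i : Fin n) : ∑ j, realMatA n i j * v j = 0 := congrFun hAv i
  have hcol (j : Fin n) : ∑ i, realMatA n i j * v i = 0 := by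
    simpa only [realMatA_comm n _ j] using hrow j
  set s := ∑ i, v i with hs
  have hform : ∑ i, ∑ j, realMatA n i j * ((n * v i - s) * (n * v j - s)) =
      s ^ 2 * ∑ i, ∑ j, realMatA n i j := by
    have h₁ : ∑ i, ∑ j, (n * (n * v i - s)) * (realMatA n i j * v j) = 0 := by
      simp only [← Finset.mul_sum, hrow, mul_zero, Finset.sum_const_zero]
    have h₂ : ∑ i, ∑ j, (n * s) * (realMatA n i j * v i) = 0 := by
      rw [Finset.sum_comm]
      simp only [← Finset.mul_sum, hcol, mul_zero, Finset.sum_const_zero]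
    rw [← sub_zero (∑ i, ∑ j, realMatA n i j * _)]
    nth_rewrite 1 [← h₁]
    rw [← add_zero (_ - _), ← h₂]
    simp only [Finset.mul_sum, ← Finset.sum_add_distrib, ← Finset.sum_sub_distrib]
    exact Finset.sum_congr rfl fun i _ => Finset.sum_congr rfl fun j _ => by ring
  have hzero : ∑ i, (n * v i - s) = 0 := by
    simp [Finset.sum_sub_distrib, ← Finset.mul_sum, ← hs]
  have hq := sum_realMatA_mul n fun i => n * v i - s
  rw [hform, hzero] at hq
  have hP := neg_le_sum_pathMatrix_mul n fun i => n * v i - s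
  have hsq : 0 ≤ ∑ i, (n * v i - s) ^ 2 := Finset.sum_nonneg fun i _ => sq_nonneg _
  have hpos := sum_realMatA_pos hn
  have hs0 : s = 0 := by
    by_contra hne
    have : 0 < s ^ 2 * ∑ i, ∑ j, realMatA n i j := by positivity
    linarith
  have hsum : ∑ i, (n * v i - s) ^ 2 = 0 := by
    have : 0 ≤ s ^ 2 * ∑ i, ∑ j, realMatA n i j := by positivity
    linarith
  refine hv (funext fun i => ?_)
  have hi := (Finset.sum_eq_zero_iff_of_nonneg fun i _ => sq_nonneg _).1 hsum i (Finset.mem_univ i)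
  have hn0 : n ≠ 0 := by omega
  simpa [hs0, hn0] using hi

/-- For every positive integer `n`, the matrix `A_n` is invertible. -/
theorem matA_isUnit (n : ℕ) (hn : 0 < n) : IsUnit (matA n) := by
  rw [Matrix.isUnit_iff_isUnit_det, isUnit_iff_ne_zero]
  rcases Nat.lt_or_ge n 4 with h | h
  · interval_cases n
    · simp [matA]
    · simp [matA, Matrix.det_fin_two]
      norm_num
    · simp [matA, Matrix.det_fin_three]
      norm_num
  · rw [← realMatA_map, ← RingHom.mapMatrix_apply, ← RingHom.map_det]
    simpa using realMatA_det_ne_zero h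
end

section
/- Let n ≥ 3 and for each 1 ≤ i ≤ n-1 let Λ_i be the Tits matrix in GL_{n-1}(ℂ). Then the family {Λ_1, …, Λ_{n-1}} acts irreducibly on ℂ^{n-1}: every linear subspace U ⊆ ℂ^{n-1} satisfying Λ_i(U) ⊆ U for all 1 ≤ i ≤ n-1 is either {0} or all of ℂ^{n-1}. In particular the Tits representation Θ : L_n → GL_{n-1}(ℂ), Θ(ℓ_i) = Λ_i, is irreducible. -/
/-- The defining relations of the triplet group `L_n`:
generators `l_1, ..., l_{n-1}` (indexed here by `Fin (n-1)`, index `i` corresponding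
to `l_{i+1}`), and relations `l_i ^ 2 = 1`, `l_i l_{i+1} l_i = l_{i+1} l_i l_{i+1}`. -/
def tripletRels (n : ℕ) : Set (FreeGroup (Fin (n - 1))) :=
  {r | (∃ i : Fin (n - 1), r = FreeGroup.of i * FreeGroup.of i) ∨
    ∃ i j : Fin (n - 1), (i : ℕ) + 1 = (j : ℕ) ∧
      r = FreeGroup.of i * FreeGroup.of j * FreeGroup.of i *
          (FreeGroup.of j * FreeGroup.of i * FreeGroup.of j)⁻¹}

/-- The triplet group `L_n`. -/
abbrev TripletGroup (n : ℕ) := PresentedGroup (tripletRels n)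

/-- The generator `l_{i+1}` of the triplet group. -/
def ell {n : ℕ} (i : Fin (n - 1)) : TripletGroup n := PresentedGroup.of i

/-- The coefficient of the `b`-th coordinate in the linear form `f_a` for which the `a`-th Tits
matrix is `u ↦ u + f_a(u) e_a`. -/
def titsCoeff {m : ℕ} (a b : Fin m) : ℝ :=
  if b = a then -2 else if (a : ℕ) + 1 = (b : ℕ) ∨ (b : ℕ) + 1 = (a : ℕ) then 1 else 2

theorem titsCoeff_ne_zero {m : ℕ} (a b : Fin m) : titsCoeff a b ≠ 0 := by
  unfold titsCoeff; split_ifs <;> norm_num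

/-- The neighbours of `a` in the path on `Fin m`. -/
def pathNeighbors {m : ℕ} (a : Fin m) : Finset (Fin m) :=
  {b | (a : ℕ) + 1 = (b : ℕ) ∨ (b : ℕ) + 1 = (a : ℕ)}

theorem mem_pathNeighbors {m : ℕ} {a b : Fin m} :
    b ∈ pathNeighbors a ↔ (a : ℕ) + 1 = (b : ℕ) ∨ (b : ℕ) + 1 = (a : ℕ) := by
  simp [pathNeighbors]

theorem mem_pathNeighbors_comm {m : ℕ} {a b : Fin m} :
    b ∈ pathNeighbors a ↔ a ∈ pathNeighbors b := by
  simp only [mem_pathNeighbors, or_comm]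

theorem card_pathNeighbors_le {m : ℕ} (a : Fin m) : (pathNeighbors a).card ≤ 2 := by
  refine (Finset.card_le_card_of_injOn (t := {(a : ℕ) + 1, (a : ℕ) - 1}) Fin.val ?_
    Fin.val_injective.injOn).trans Finset.card_le_two
  intro b hb
  have := mem_pathNeighbors.1 hb
  simp only [Finset.coe_insert, Finset.coe_singleton, Set.mem_insert_iff, Set.mem_singleton_iff]
  omega

theorem sum_pathNeighbors_le {m : ℕ} {x : Fin m → ℝ} {c : ℝ} (hc : 0 ≤ c) (hx : ∀ b, x b ≤ c)
    (a : Fin m) : ∑ b ∈ pathNeighbors a, x b ≤ 2 * c := by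
  refine (Finset.sum_le_card_nsmul _ _ c fun b _ => hx b).trans ?_
  rw [nsmul_eq_mul]
  exact mul_le_mul_of_nonneg_right (mod_cast card_pathNeighbors_le a) hc

theorem sum_titsCoeff_mul {m : ℕ} (x : Fin m → ℝ) (a : Fin m) :
    ∑ b, titsCoeff a b * x b = 2 * ∑ b, x b - 4 * x a - ∑ b ∈ pathNeighbors a, x b := by
  have key (b : Fin m) : titsCoeff a b * x b =
      2 * x b - (if b = a then 4 * x b else 0) - (if b ∈ pathNeighbors a then x b else 0) := by
    have hne : b ∈ pathNeighbors a → b ≠ a := by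
      rintro hb rfl
      have := mem_pathNeighbors.1 hb
      omega
    by_cases hba : b = a
    · have hb : b ∉ pathNeighbors a := fun hb => hne hb hba
      rw [titsCoeff, if_pos hba, if_pos hba, if_neg hb]; ring
    · by_cases hb : b ∈ pathNeighbors a
      · rw [titsCoeff, if_neg hba, if_neg hba, if_pos hb, if_pos (mem_pathNeighbors.1 hb)]; ring
      · rw [titsCoeff, if_neg hba, if_neg hba, if_neg hb, if_neg (mt mem_pathNeighbors.2 hb)]; ring
  simp only [key, Finset.sum_sub_distrib, ← Finset.mul_sum, Finset.sum_ite_eq', Finset.mem_univ,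
    if_true, Finset.sum_ite_mem, Finset.univ_inter]

theorem eq_zero_of_sum_titsCoeff_mul_of_sum_nonneg {m : ℕ} (hm : 4 ≤ m) {x : Fin m → ℝ}
    (h : ∀ a, ∑ b, titsCoeff a b * x b = 0) (hS : 0 ≤ ∑ b, x b) : x = 0 := by
  simp only [sum_titsCoeff_mul] at h
  set S := ∑ b, x b with hS_def
  have : Nonempty (Fin m) := ⟨⟨0, by omega⟩⟩
  obtain ⟨a₀, ha₀⟩ := Finite.exists_max fun a => |x a|
  have habs : |x a₀| ≤ S := by
    have h₁ := sum_pathNeighbors_le (abs_nonneg (x a₀)) ha₀ a₀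
    have h₂ := Finset.abs_sum_le_sum_abs x (pathNeighbors a₀)
    have h₃ := h a₀
    have h₄ := abs_le.1 h₂
    rcases abs_cases (x a₀) with h₅ | h₅ <;> linarith
  have hle (a : Fin m) : x a ≤ S := (le_abs_self _).trans ((ha₀ a).trans habs)
  have hnonneg (a : Fin m) : 0 ≤ x a := by
    linarith [h a, sum_pathNeighbors_le hS hle a]
  have hdouble : ∑ a, ∑ b ∈ pathNeighbors a, x b ≤ 2 * S := by
    rw [Finset.sum_comm' (t' := Finset.univ) (s' := pathNeighbors)
      (by simp [mem_pathNeighbors_comm]), hS_def, Finset.mul_sum]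
    refine Finset.sum_le_sum fun b _ => ?_
    exact sum_pathNeighbors_le (x := fun _ => x b) (hnonneg b) (fun _ => le_rfl) b
  have hsum : ∑ a, (2 * S - 4 * x a - ∑ b ∈ pathNeighbors a, x b) = 0 :=
    Finset.sum_eq_zero fun a _ => h a
  simp only [Finset.sum_sub_distrib, ← Finset.mul_sum, Finset.sum_const, Finset.card_univ,
    Fintype.card_fin, nsmul_eq_mul] at hsum
  have hm' : (4 : ℝ) ≤ m := mod_cast hm
  have hS0 : S ≤ 0 := by nlinarith
  funext a
  exact le_antisymm ((hle a).trans hS0) (hnonneg a)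

/-- The matrix of the linear forms `f_a` is nonsingular. -/
theorem eq_zero_of_sum_titsCoeff_mul {m : ℕ} (hm : 2 ≤ m) {x : Fin m → ℝ}
    (h : ∀ a, ∑ b, titsCoeff a b * x b = 0) : x = 0 := by
  obtain rfl | rfl | hm : m = 2 ∨ m = 3 ∨ 4 ≤ m := by omega
  · have h₀ := h 0
    have h₁ := h 1
    simp [titsCoeff, Fin.sum_univ_succ] at h₀ h₁
    funext a
    fin_cases a <;> simp <;> linarith
  · have h₀ := h 0
    have h₁ := h 1
    have h₂ := h 2
    simp [titsCoeff, Fin.sum_univ_three] at h₀ h₁ h₂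
    funext a
    fin_cases a <;> simp <;> linarith
  · rcases le_total 0 (∑ b, x b) with hS | hS
    · exact eq_zero_of_sum_titsCoeff_mul_of_sum_nonneg hm h hS
    · refine neg_eq_zero.1 (eq_zero_of_sum_titsCoeff_mul_of_sum_nonneg hm (x := -x) ?_ ?_)
      · simpa using h
      · simpa using hS

theorem eq_zero_of_sum_titsCoeff_mul_complex {m : ℕ} (hm : 2 ≤ m) {u : Fin m → ℂ}
    (h : ∀ a, ∑ b, (titsCoeff a b : ℂ) * u b = 0) : u = 0 := by
  have hre := eq_zero_of_sum_titsCoeff_mul hm (x := fun b => (u b).re) fun a => by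
    simpa using congrArg Complex.re (h a)
  have him := eq_zero_of_sum_titsCoeff_mul hm (x := fun b => (u b).im) fun a => by
    simpa using congrArg Complex.im (h a)
  funext a
  exact Complex.ext (congrFun hre a) (congrFun him a)

theorem titsMat_mulVec (n : ℕ) (i : Fin (n - 1)) (u : Fin (n - 1) → ℂ) :
    (titsMat n i).mulVec u = u + (∑ b, (titsCoeff i b : ℂ) * u b) • Pi.single i 1 := by
  funext a
  by_cases ha : a = i
  · subst ha
    have key (b : Fin (n - 1)) :
        titsMat n a a b * u b = (if b = a then u b else 0) + (titsCoeff a b : ℂ) * u b := by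
      simp only [titsMat, titsCoeff, Matrix.of_apply, if_true]
      split_ifs <;> push_cast <;> ring
    simp [Matrix.mulVec, dotProduct, key, Finset.sum_add_distrib]
  · simp [Matrix.mulVec, dotProduct, titsMat, ha]

theorem titsMat_invariant_eq_bot_or_eq_top {n : ℕ} (hn : 3 ≤ n)
    (U : Submodule ℂ (Fin (n - 1) → ℂ))
    (hU : ∀ i : Fin (n - 1), ∀ u ∈ U, (titsMat n i).mulVec u ∈ U) : U = ⊥ ∨ U = ⊤ := by
  have hsingle {i : Fin (n - 1)} {u : Fin (n - 1) → ℂ} (hu : u ∈ U)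
      (hne : ∑ b, (titsCoeff i b : ℂ) * u b ≠ 0) : Pi.single i 1 ∈ U := by
    have := hU i u hu
    rw [titsMat_mulVec, U.add_mem_iff_right hu] at this
    exact (U.smul_mem_iff hne).1 this
  by_cases hker : ∀ u ∈ U, ∀ i, ∑ b, (titsCoeff i b : ℂ) * u b = 0
  · left
    rw [Submodule.eq_bot_iff]
    exact fun u hu => eq_zero_of_sum_titsCoeff_mul_complex (by omega) (hker u hu)
  · right
    push Not at hker
    obtain ⟨u, hu, i, hi⟩ := hker
    have hall (j : Fin (n - 1)) : Pi.single j 1 ∈ U := by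
      refine hsingle (hsingle hu hi) ?_
      simpa [Pi.single_apply] using titsCoeff_ne_zero j i
    rw [Submodule.eq_top_iff']
    intro v
    rw [pi_eq_sum_univ' v]
    refine U.sum_mem fun j _ => U.smul_mem _ ?_
    convert hall j using 1

/-- For `n >= 3`, the family of Tits matrices acts irreducibly on
`ℂ^(n-1)`: every subspace invariant under all of them is trivial or everything. In
particular, any representation of the triplet group `L_n` sending each generator to the
corresponding Tits matrix (the Tits representation) is irreducible. -/
theorem tits_irreducible (n : ℕ) (hn : 3 ≤ n) :
    (∀ U : Submodule ℂ (Fin (n - 1) → ℂ),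
      (∀ i : Fin (n - 1), ∀ u ∈ U, (titsMat n i).mulVec u ∈ U) →
      U = ⊥ ∨ U = ⊤) ∧
    ∀ Θ : TripletGroup n →* Matrix.GeneralLinearGroup (Fin (n - 1)) ℂ,
      (∀ i : Fin (n - 1), Units.val (Θ (ell i)) = titsMat n i) →
      ∀ U : Submodule ℂ (Fin (n - 1) → ℂ),
        (∀ g : TripletGroup n, ∀ u ∈ U, (Units.val (Θ g)).mulVec u ∈ U) →
        U = ⊥ ∨ U = ⊤ := by
  refine ⟨titsMat_invariant_eq_bot_or_eq_top hn, fun Θ hΘ U hU => ?_⟩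
  refine titsMat_invariant_eq_bot_or_eq_top hn U fun i u hu => ?_
  rw [← hΘ i]
  exact hU (ell i) u hu
end

section
/- Fix n ≥ 2 and k ∈ ℤ. Let F be the free group on the n+1 generators x_1, …, x_n, t, and for each 1 ≤ i ≤ n-1 let φ_i : F → F be the endomorphism determined on generators by φ_i(x_i) = t^k x_{i+1}, φ_i(x_{i+1}) = t^{-k} x_i, φ_i(x_j) = x_j for j ∉ {i, i+1}, and φ_i(t) = t. Then each φ_i is an automorphism of F, and the φ_i satisfy φ_i ∘ φ_i = id for 1 ≤ i ≤ n-1 and φ_i ∘ φ_{i+1} ∘ φ_i = φ_{i+1} ∘ φ_i ∘ φ_{i+1} for 1 ≤ i ≤ n-2. Consequently there exists a group homomorphism μ : L_n → Aut(F) with μ(ℓ_i) = φ_i for all 1 ≤ i ≤ n-1. -/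
/-- The endomorphism `phi_i` of the free group on `x_1, ..., x_n, t` (here `x_j` is
`FreeGroup.of (some j)` with 0-based `j`, and `t` is `FreeGroup.of none`), determined
on generators by `phi_i (x_i) = t^k x_(i+1)`, `phi_i (x_(i+1)) = t^(-k) x_i`,
`phi_i (x_j) = x_j` otherwise, and `phi_i (t) = t` (generator index `i` 0-based). -/
def phiMap (n : ℕ) (k : ℤ) (i : Fin (n - 1)) :
    FreeGroup (Option (Fin n)) →* FreeGroup (Option (Fin n)) :=
  FreeGroup.lift fun a =>
    match a with
    | none => FreeGroup.of none
    | some j =>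
      if (j : ℕ) = (i : ℕ) then
        (FreeGroup.of (none : Option (Fin n))) ^ k *
          FreeGroup.of (some ⟨(i : ℕ) + 1, by have := i.isLt; omega⟩)
      else if (j : ℕ) = (i : ℕ) + 1 then
        (FreeGroup.of (none : Option (Fin n))) ^ (-k) *
          FreeGroup.of (some ⟨(i : ℕ), by have := i.isLt; omega⟩)
      else FreeGroup.of (some j)

section phiMap

variable {n : ℕ} {k : ℤ}

theorem phiMap_of_none (i : Fin (n - 1)) :
    phiMap n k i (FreeGroup.of none) = FreeGroup.of none := by
  simp [phiMap]

theorem phiMap_of_some_self (i : Fin (n - 1)) {a b : Fin n} (ha : (a : ℕ) = i)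
    (hb : (b : ℕ) = i + 1) :
    phiMap n k i (FreeGroup.of (some a)) = FreeGroup.of none ^ k * FreeGroup.of (some b) := by
  simp [phiMap, ha, ← hb]

theorem phiMap_of_some_succ (i : Fin (n - 1)) {a b : Fin n} (ha : (a : ℕ) = i)
    (hb : (b : ℕ) = i + 1) :
    phiMap n k i (FreeGroup.of (some b)) =
      FreeGroup.of none ^ (-k) * FreeGroup.of (some a) := by
  simp [phiMap, hb, ← ha]

theorem phiMap_of_some_of_ne (i : Fin (n - 1)) {a : Fin n} (h : (a : ℕ) ≠ i)
    (h' : (a : ℕ) ≠ i + 1) :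
    phiMap n k i (FreeGroup.of (some a)) = FreeGroup.of (some a) := by
  simp [phiMap, h, h']

theorem phiMap_comp_self (i : Fin (n - 1)) :
    (phiMap n k i).comp (phiMap n k i) = MonoidHom.id _ := by
  obtain ⟨a, ha⟩ : ∃ a : Fin n, (a : ℕ) = i := ⟨⟨i, by omega⟩, rfl⟩
  obtain ⟨b, hb⟩ : ∃ b : Fin n, (b : ℕ) = i + 1 := ⟨⟨i + 1, by omega⟩, rfl⟩
  have h_self := phiMap_of_some_self (k := k) i ha hb
  have h_succ := phiMap_of_some_succ (k := k) i ha hb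
  ext (_ | j)
  · simp [phiMap_of_none]
  · by_cases hja : j = a
    · subst hja
      simp [h_self, h_succ, phiMap_of_none]
    by_cases hjb : j = b
    · subst hjb
      simp [h_self, h_succ, phiMap_of_none]
    have hj := phiMap_of_some_of_ne (k := k) i (a := j) (by omega) (by omega)
    simp [hj]

theorem phiMap_braid {i j : Fin (n - 1)} (hij : (i : ℕ) + 1 = j) :
    (phiMap n k i).comp ((phiMap n k j).comp (phiMap n k i)) =
      (phiMap n k j).comp ((phiMap n k i).comp (phiMap n k j)) := by
  obtain ⟨a, ha⟩ : ∃ a : Fin n, (a : ℕ) = i := ⟨⟨i, by omega⟩, rfl⟩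
  obtain ⟨b, hb⟩ : ∃ b : Fin n, (b : ℕ) = i + 1 := ⟨⟨i + 1, by omega⟩, rfl⟩
  obtain ⟨c, hc⟩ : ∃ c : Fin n, (c : ℕ) = j + 1 := ⟨⟨j + 1, by omega⟩, rfl⟩
  have hia := phiMap_of_some_self (k := k) i ha hb
  have hib := phiMap_of_some_succ (k := k) i ha hb
  have hic := phiMap_of_some_of_ne (k := k) i (a := c) (by omega) (by omega)
  have hja := phiMap_of_some_of_ne (k := k) j (a := a) (by omega) (by omega)
  have hjb := phiMap_of_some_self (k := k) j (hb.trans hij) hc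
  have hjc := phiMap_of_some_succ (k := k) j (hb.trans hij) hc
  ext (_ | m)
  · simp [phiMap_of_none]
  · by_cases hma : m = a
    · subst hma
      simp [hia, hic, hja, hjb, phiMap_of_none]
    by_cases hmb : m = b
    · subst hmb
      simp [hia, hib, hic, hja, hjb, hjc, phiMap_of_none]
    by_cases hmc : m = c
    · subst hmc
      simp [hib, hic, hja, hjc, phiMap_of_none]
    have him := phiMap_of_some_of_ne (k := k) i (a := m) (by omega) (by omega)
    have hjm := phiMap_of_some_of_ne (k := k) j (a := m) (by omega) (by omega)
    simp [him, hjm]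

/-- The automorphism of the free group given by `phiMap n k i`, which is its own inverse. -/
def phiAut (n : ℕ) (k : ℤ) (i : Fin (n - 1)) : MulAut (FreeGroup (Option (Fin n))) :=
  (phiMap n k i).toMulEquiv (phiMap n k i) (phiMap_comp_self i) (phiMap_comp_self i)

theorem phiAut_apply (i : Fin (n - 1)) (w : FreeGroup (Option (Fin n))) :
    phiAut n k i w = phiMap n k i w :=
  rfl

theorem lift_phiAut_eq_one {r : FreeGroup (Fin (n - 1))} (hr : r ∈ tripletRels n) :
    FreeGroup.lift (phiAut n k) r = 1 := by
  rcases hr with ⟨i, rfl⟩ | ⟨i, j, hij, rfl⟩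
  · rw [map_mul, FreeGroup.lift_apply_of]
    exact MulEquiv.ext fun w => DFunLike.congr_fun (phiMap_comp_self i) w
  · rw [map_mul, map_inv, mul_inv_eq_one]
    simp only [map_mul, FreeGroup.lift_apply_of]
    exact MulEquiv.ext fun w => DFunLike.congr_fun (phiMap_braid hij) w

end phiMap

/-- Each `phi_i` is an automorphism of the free group `F` on
`x_1, ..., x_n, t`; they satisfy `phi_i ∘ phi_i = id` and the braid relations
`phi_i phi_(i+1) phi_i = phi_(i+1) phi_i phi_(i+1)`; consequently there is a group
homomorphism `mu : L_n → Aut F` with `mu (l_i) = phi_i` for all `i`. -/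
theorem phiMap_defines_rep (n : ℕ) (hn : 2 ≤ n) (k : ℤ) :
    (∀ i : Fin (n - 1), Function.Bijective (phiMap n k i)) ∧
    (∀ i : Fin (n - 1), ∀ w, phiMap n k i (phiMap n k i w) = w) ∧
    (∀ i j : Fin (n - 1), (i : ℕ) + 1 = (j : ℕ) →
      ∀ w, phiMap n k i (phiMap n k j (phiMap n k i w)) =
           phiMap n k j (phiMap n k i (phiMap n k j w))) ∧
    ∃ μ : TripletGroup n →* MulAut (FreeGroup (Option (Fin n))),
      ∀ i : Fin (n - 1), ∀ w, (μ (ell i)) w = phiMap n k i w := by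
  exact ⟨fun i => (phiAut n k i).bijective,
    fun i w => DFunLike.congr_fun (phiMap_comp_self i) w,
    fun i j hij w => DFunLike.congr_fun (phiMap_braid hij) w,
    PresentedGroup.toGroup fun r hr => lift_phiAut_eq_one hr, fun i w => by
      rw [ell, PresentedGroup.toGroup.of, phiAut_apply]⟩
end

section
/- For every n ≥ 4 and every k ∈ ℤ, the kernel of the representation μ' : L_n → GL_n(ℤ[t^{±1}]) equals the pure triplet group PL_n, that is, ker(μ') = ker(π) where π : L_n → S_n is the homomorphism with π(ℓ_i) = (i i+1) for 1 ≤ i ≤ n-1. -/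
/-- The `n x n` matrix `diag(I_i, M, I_{n-i-2})`: it agrees with the identity matrix
except in the `2 x 2` block in rows/columns `i, i+1` (0-based), where it equals `M`. -/
def locMat {R : Type*} [CommRing R] (n : ℕ) (i : ℕ)
    (M : Matrix (Fin 2) (Fin 2) R) : Matrix (Fin n) (Fin n) R :=
  Matrix.of fun a b =>
    if (a : ℕ) = i ∧ (b : ℕ) = i then M 0 0
    else if (a : ℕ) = i ∧ (b : ℕ) = i + 1 then M 0 1
    else if (a : ℕ) = i + 1 ∧ (b : ℕ) = i then M 1 0
    else if (a : ℕ) = i + 1 ∧ (b : ℕ) = i + 1 then M 1 1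
    else if (a : ℕ) = (b : ℕ) then 1 else 0

/-- The matrix `P_i` in `GL_n(Z[t,t^-1])`: identity except for the `2 x 2` block
`[[0, t^k], [t^(-k), 0]]` in rows/columns `i, i+1` (0-based `i`). -/
noncomputable def PMat (n : ℕ) (k : ℤ) (i : ℕ) :
    Matrix (Fin n) (Fin n) (LaurentPolynomial ℤ) :=
  locMat n i !![0, LaurentPolynomial.T k; LaurentPolynomial.T (-k), 0]

/-- The permutation matrix of `σ` conjugated by the diagonal matrix with entries `T (-k * a)`,
as a monoid homomorphism. -/
noncomputable def twistedPermMatrix (n : ℕ) (k : ℤ) :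
    Equiv.Perm (Fin n) →* Matrix (Fin n) (Fin n) (LaurentPolynomial ℤ) where
  toFun σ := Matrix.of fun a b =>
    if a = σ b then LaurentPolynomial.T (k * ((b : ℤ) - (a : ℤ))) else 0
  map_one' := by
    ext1 a b
    by_cases h : a = b <;> simp [h, Matrix.one_apply]
  map_mul' σ τ := by
    ext1 a b
    rw [Matrix.mul_apply, Finset.sum_eq_single (τ b)]
    · by_cases h : a = σ (τ b)
      · rw [Matrix.of_apply, Matrix.of_apply, Matrix.of_apply, if_pos h, if_pos rfl,
          Equiv.Perm.mul_apply, if_pos h, ← LaurentPolynomial.T_add]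
        congr 1
        ring
      · rw [Matrix.of_apply, Matrix.of_apply, Matrix.of_apply, Equiv.Perm.mul_apply, if_neg h,
          if_neg h, zero_mul]
    · intro c _ hc
      rw [Matrix.of_apply, Matrix.of_apply, if_neg hc, mul_zero]
    · exact fun hb => absurd (Finset.mem_univ _) hb

theorem twistedPermMatrix_apply (n : ℕ) (k : ℤ) (σ : Equiv.Perm (Fin n)) (a b : Fin n) :
    twistedPermMatrix n k σ a b =
      if a = σ b then LaurentPolynomial.T (k * ((b : ℤ) - (a : ℤ))) else 0 :=
  rfl

theorem twistedPermMatrix_injective (n : ℕ) (k : ℤ) :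
    Function.Injective (twistedPermMatrix n k) := by
  intro σ τ h
  ext1 b
  by_contra hne
  have hb := congrFun (congrFun h (σ b)) b
  rw [twistedPermMatrix_apply, twistedPermMatrix_apply, if_pos rfl, if_neg hne] at hb
  exact (LaurentPolynomial.isUnit_T _).ne_zero hb

theorem twistedPermMatrix_swap (n : ℕ) (k : ℤ) (i : ℕ) (hi : i + 1 < n) :
    twistedPermMatrix n k (Equiv.swap ⟨i, by omega⟩ ⟨i + 1, hi⟩) = PMat n k i := by
  ext1 a b
  rw [twistedPermMatrix_apply, Equiv.swap_apply_def]
  simp only [PMat, locMat, Matrix.of_apply, Fin.ext_iff]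
  by_cases hb : (b : ℕ) = i
  · by_cases ha : (a : ℕ) = i + 1
    · simp [ha, hb]
    · simp [ha, hb]
  · by_cases hb' : (b : ℕ) = i + 1
    · by_cases ha : (a : ℕ) = i
      · simp [ha, hb']
      · simp [ha, hb']
    · by_cases hab : (a : ℕ) = b
      · simp [hab, hb, hb']
      · simp [hab, hb, hb']

/-- For `n >= 4` and every `k : ℤ`, the kernel of the representation
`mu' : L_n → GL_n (Z[t,t^-1])` equals the pure triplet group `PL_n`, i.e. the kernel
of the homomorphism `pi : L_n → S_n` sending `l_i` to the transposition `(i, i+1)`. -/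
theorem muPrime_ker_eq_pure (n : ℕ) (hn : 4 ≤ n) (k : ℤ)
    (μ' : TripletGroup n →* Matrix.GeneralLinearGroup (Fin n) (LaurentPolynomial ℤ))
    (hμ : ∀ i : Fin (n - 1), Units.val (μ' (ell i)) = PMat n k (i : ℕ))
    (π : TripletGroup n →* Equiv.Perm (Fin n))
    (hπ : ∀ i : Fin (n - 1),
      π (ell i) = Equiv.swap ⟨(i : ℕ), by have := i.isLt; omega⟩
                             ⟨(i : ℕ) + 1, by have := i.isLt; omega⟩) :
    μ'.ker = π.ker := by
  have h : μ' = (twistedPermMatrix n k).toHomUnits.comp π := by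
    refine PresentedGroup.ext fun i => Units.ext ?_
    have hi := i.isLt
    change Units.val (μ' (ell i)) = twistedPermMatrix n k (π (ell i))
    rw [hμ, hπ, twistedPermMatrix_swap n k i (by omega)]
  ext g
  rw [MonoidHom.mem_ker, MonoidHom.mem_ker, h, Units.ext_iff]
  change twistedPermMatrix n k (π g) = 1 ↔ π g = 1
  exact map_eq_one_iff _ (twistedPermMatrix_injective n k)
end

section
/- Fix n ≥ 2 and k ∈ ℤ. Let w ∈ (ℤ[t^{±1}])^n be the column vector with entries w_j = t^{k(n-j)} for 1 ≤ j ≤ n. Then w ≠ 0 and μ'(g)·w = w for every g ∈ L_n. In particular, the free rank-one submodule spanned by w is a nonzero proper invariant submodule, so the representation μ' is reducible for all n ≥ 2. -/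
/-- The vector `j ↦ t^(k(c - j))` is fixed by every `P_i`. -/
theorem PMat_mulVec (n : ℕ) (k c : ℤ) (i : ℕ) (hi : i + 1 < n) :
    (PMat n k i).mulVec (fun j : Fin n => LaurentPolynomial.T (k * (c - ((j : ℕ) : ℤ)))) =
      fun j : Fin n => LaurentPolynomial.T (k * (c - ((j : ℕ) : ℤ))) := by
  funext a
  simp only [Matrix.mulVec, dotProduct, PMat, locMat, Matrix.of_apply]
  by_cases h₀ : (a : ℕ) = i
  · rw [Finset.sum_eq_single (⟨i + 1, hi⟩ : Fin n)]
    · simp only [h₀, Nat.succ_ne_self, and_false, and_true, if_false, if_true,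
        Matrix.cons_val]
      rw [← LaurentPolynomial.T_add]
      congr 1
      push_cast
      ring
    · intro b _ hb
      have hb' : (b : ℕ) ≠ i + 1 := fun h => hb (Fin.ext h)
      by_cases hbi : (b : ℕ) = i
      · simp [h₀, hbi]
      · simp [h₀, hb', hbi, Ne.symm hbi]
    · exact fun h => absurd (Finset.mem_univ _) h
  · by_cases h₁ : (a : ℕ) = i + 1
    · rw [Finset.sum_eq_single (⟨i, by omega⟩ : Fin n)]
      · simp only [h₁, Nat.succ_ne_self, (Nat.succ_ne_self i).symm, and_false, and_true,
          if_false, if_true, Matrix.cons_val]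
        rw [← LaurentPolynomial.T_add]
        congr 1
        push_cast
        ring
      · intro b _ hb
        have hb' : (b : ℕ) ≠ i := fun h => hb (Fin.ext h)
        by_cases hbi : (b : ℕ) = i + 1
        · simp [h₁, hbi]
        · simp [h₁, hb', hbi, Ne.symm hbi]
      · exact fun h => absurd (Finset.mem_univ _) h
    · simp [h₀, h₁, ← Fin.ext_iff]

/-- For `n >= 2` and `k : ℤ`, the vector `w` with entries
`w_j = t^(k(n-j))` (1-based `j`; with 0-based `j` this is `t^(k(n-1-j))`) is nonzero
and fixed by `mu' g` for every `g` in `L_n`; the rank-one submodule it spans is a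
nonzero proper invariant submodule, so `mu'` is reducible for all `n >= 2`. -/
theorem muPrime_reducible (n : ℕ) (hn : 2 ≤ n) (k : ℤ)
    (μ' : TripletGroup n →* Matrix.GeneralLinearGroup (Fin n) (LaurentPolynomial ℤ))
    (hμ : ∀ i : Fin (n - 1), Units.val (μ' (ell i)) = PMat n k (i : ℕ)) :
    let w : Fin n → LaurentPolynomial ℤ :=
      fun j => LaurentPolynomial.T (k * ((n : ℤ) - 1 - ((j : ℕ) : ℤ)))
    w ≠ 0 ∧
    (∀ g : TripletGroup n, (Units.val (μ' g)).mulVec w = w) ∧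
    Submodule.span (LaurentPolynomial ℤ) {w} ≠ ⊥ ∧
    Submodule.span (LaurentPolynomial ℤ) {w} ≠ ⊤ ∧
    (∀ g : TripletGroup n, ∀ v ∈ Submodule.span (LaurentPolynomial ℤ) {w},
      (Units.val (μ' g)).mulVec v ∈ Submodule.span (LaurentPolynomial ℤ) {w}) := by
  intro w
  have hw : w ≠ 0 := fun h =>
    (LaurentPolynomial.isUnit_T (R := ℤ) _).ne_zero (congrFun h (⟨0, by omega⟩ : Fin n))
  have hfix : ∀ g : TripletGroup n, (Units.val (μ' g)).mulVec w = w := by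
    intro g
    have hg : g ∈ Subgroup.closure (Set.range (PresentedGroup.of (rels := tripletRels n))) := by
      simp
    induction hg using Subgroup.closure_induction with
    | mem x hx =>
      obtain ⟨i, rfl⟩ := hx
      exact (congrArg (Matrix.mulVec · w) (hμ i)).trans
        (PMat_mulVec n k ((n : ℤ) - 1) i (by omega))
    | one => simp
    | mul x y _ _ hx hy => rw [map_mul, Units.val_mul, ← Matrix.mulVec_mulVec, hy, hx]
    | inv x _ hx =>
      conv_lhs => rw [← hx]
      rw [Matrix.mulVec_mulVec, ← Units.val_mul, ← map_mul, inv_mul_cancel]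
      simp
  refine ⟨hw, hfix, by simpa using hw, fun htop => ?_, fun g v hv => ?_⟩
  · have hmem : Pi.single (⟨0, by omega⟩ : Fin n) (1 : LaurentPolynomial ℤ) ∈
        Submodule.span (LaurentPolynomial ℤ) {w} := htop ▸ Submodule.mem_top
    obtain ⟨c, hc⟩ := Submodule.mem_span_singleton.1 hmem
    have hc₁ := congrFun hc (⟨1, by omega⟩ : Fin n)
    have hc₀ : c = 0 := by
      rw [Pi.single_eq_of_ne (by simp)] at hc₁
      exact (LaurentPolynomial.isUnit_T _).mul_left_eq_zero.1 hc₁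
    simpa [hc₀] using congrFun hc (⟨0, by omega⟩ : Fin n)
  · obtain ⟨c, rfl⟩ := Submodule.mem_span_singleton.1 hv
    rw [Matrix.mulVec_smul, hfix]
    exact hv
end

section
/- Fix n ≥ 3 and let a, b, c, d ∈ ℂ with ad - bc ≠ 0, and set M = [[a,b],[c,d]]. For 1 ≤ i ≤ n-1 let L_i = diag(I_{i-1}, M, I_{n-i-1}) ∈ GL_n(ℂ). Suppose that L_i² = I_n for 1 ≤ i ≤ n-1 and L_i L_{i+1} L_i = L_{i+1} L_i L_{i+1} for 1 ≤ i ≤ n-2 (so that ℓ_i ↦ L_i defines a homogeneous 2-local representation of L_n), and suppose M ≠ I₂ (the representation is non-trivial). Then a = d = 0 and bc = 1; that is, M = [[0, b],[1/b, 0]] for some b ∈ ℂ*. -/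
/-- Fix `n >= 3`, let `M = [[a,b],[c,d]]` be an invertible complex
matrix and let `L_i = diag(I_(i-1), M, I_(n-i-1))`. If the `L_i` satisfy `L_i ^ 2 = 1`
and the braid relations (so that `l_i ↦ L_i` is a homogeneous 2-local representation
of `L_n`) and `M ≠ I_2`, then `a = d = 0` and `b * c = 1`, i.e. `M = [[0, b],[1/b, 0]]`
with `b` nonzero. -/
theorem homogeneous_two_local_classification (n : ℕ) (hn : 3 ≤ n)
    (a b c d : ℂ) (hdet : a * d - b * c ≠ 0)
    (hsq : ∀ i : Fin (n - 1),
      locMat n (i : ℕ) !![a, b; c, d] * locMat n (i : ℕ) !![a, b; c, d] = 1)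
    (hbr : ∀ i j : Fin (n - 1), (i : ℕ) + 1 = (j : ℕ) →
      locMat n (i : ℕ) !![a, b; c, d] * locMat n (j : ℕ) !![a, b; c, d] *
        locMat n (i : ℕ) !![a, b; c, d] =
      locMat n (j : ℕ) !![a, b; c, d] * locMat n (i : ℕ) !![a, b; c, d] *
        locMat n (j : ℕ) !![a, b; c, d])
    (hnt : !![a, b; c, d] ≠ (1 : Matrix (Fin 2) (Fin 2) ℂ)) :
    a = 0 ∧ d = 0 ∧ b * c = 1 := by
  obtain ⟨m, rfl⟩ : ∃ m, n = m + 3 := ⟨n - 3, by omega⟩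
  have hs := hsq ⟨0, by omega⟩
  have hb := hbr ⟨0, by omega⟩ ⟨1, by omega⟩ rfl
  have s00 := congrFun (congrFun hs 0) 0
  have s01 := congrFun (congrFun hs 0) 1
  have s10 := congrFun (congrFun hs 1) 0
  have s11 := congrFun (congrFun hs 1) 1
  have b00 := congrFun (congrFun hb 0) 0
  have b11 := congrFun (congrFun hb 1) 1
  simp [Matrix.mul_apply, locMat, Fin.sum_univ_succ] at s00 s01 s10 s11 b00 b11
  by_cases htr : a + d = 0
  · obtain rfl : d = -a := by linear_combination htr
    have ha : a ^ 2 * (a - 1) = 0 := by linear_combination a * s00 - b00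
    rcases mul_eq_zero.mp ha with ha | ha
    · obtain rfl : a = 0 := by simpa using ha
      exact ⟨rfl, neg_zero, by linear_combination s00⟩
    · obtain rfl : a = 1 := by linear_combination ha
      exfalso
      norm_num at s00 b11
      grind
  · have hb0 : b = 0 := by
      have : b * (a + d) = 0 := by linear_combination s01
      simpa [htr] using this
    have hc0 : c = 0 := by
      have : c * (a + d) = 0 := by linear_combination s10
      simpa [htr] using this
    subst hb0 hc0
    obtain rfl : a = 1 := by linear_combination s00 - b00
    obtain rfl : d = 1 := by grind
    exact absurd Matrix.one_fin_two.symm hnt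
end

section
/- Fix n ≥ 3 and let λ : L_n → GL_n(ℂ) be a non-trivial complex homogeneous 2-local representation. Then there exists b ∈ ℂ* such that for every 1 ≤ i ≤ n-1, λ(ℓ_i) = diag(I_{i-1}, [[0,b],[1/b,0]], I_{n-i-1}); equivalently, λ(ℓ_i) is the image of μ'(ℓ_i) (taken with parameter k = 1) under the entrywise application of the ring homomorphism ℤ[t^{±1}] → ℂ sending t to b. Hence λ is the complex specialization of μ' at t = b. -/
/-- The first three rows of a product whose left factor is `locMat` with its block in the first
three coordinates. -/
theorem locMat_mul_apply {R : Type*} [CommRing R] (m i : ℕ) (hi : i ≤ 1)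
    (M : Matrix (Fin 2) (Fin 2) R) (N : Matrix (Fin (m + 3)) (Fin (m + 3)) R)
    (a b : Fin (m + 3)) (ha : (a : ℕ) < 3) :
    (locMat (m + 3) i M * N) a b =
      locMat (m + 3) i M a 0 * N 0 b + locMat (m + 3) i M a 1 * N 1 b +
        locMat (m + 3) i M a 2 * N 2 b := by
  have hz : ∀ x : Fin m, locMat (m + 3) i M a x.succ.succ.succ = 0 := by
    intro x
    simp only [locMat, Matrix.of_apply, Fin.val_succ]
    grind
  rw [Matrix.mul_apply, Fin.sum_univ_succ, Fin.sum_univ_succ, Fin.sum_univ_succ]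
  simp only [hz, zero_mul, Finset.sum_const_zero, add_zero, ← add_assoc]
  rfl

/-- A local block whose translates satisfy the triplet relations is either trivial or
antidiagonal. -/
theorem eq_one_or_antidiagonal {K : Type*} [Field K] [NeZero (2 : K)] (m : ℕ)
    (M : Matrix (Fin 2) (Fin 2) K)
    (hsq : locMat (m + 3) 0 M * locMat (m + 3) 0 M = 1)
    (hbraid : locMat (m + 3) 0 M * (locMat (m + 3) 1 M * locMat (m + 3) 0 M) =
      locMat (m + 3) 1 M * (locMat (m + 3) 0 M * locMat (m + 3) 1 M)) :
    M = 1 ∨ ∃ b : K, b ≠ 0 ∧ M = !![0, b; 1 / b, 0] := by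
  have h2 : (2 : K) ≠ 0 := NeZero.ne 2
  have s := fun a b => congrFun (congrFun hsq a) b
  have r := fun a b => congrFun (congrFun hbraid a) b
  have s00 := s 0 0
  have s01 := s 0 1
  have s10 := s 1 0
  have s11 := s 1 1
  have r00 := r 0 0
  have r22 := r 2 2
  have v2 : ((2 : Fin (m + 3)) : ℕ) = 2 := rfl
  have v1 : ((1 : Fin (m + 3)) : ℕ) = 1 := rfl
  have v0 : ((0 : Fin (m + 3)) : ℕ) = 0 := rfl
  simp only [locMat_mul_apply, zero_le_one, le_refl, v0, v1, v2, Nat.ofNat_pos, Nat.one_lt_ofNat,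
    Nat.reduceLT] at s00 s01 s10 s11 r00 r22
  simp only [v0, v1, v2, locMat, Matrix.of_apply, Matrix.one_apply, Fin.ext_iff]
    at s00 s01 s10 s11 r00 r22
  simp at s00 s01 s10 s11 r00 r22
  clear s r hsq hbraid
  rw [Matrix.eta_fin_two M, Matrix.one_fin_two]
  generalize M 0 0 = a at *
  generalize M 0 1 = b at *
  generalize M 1 0 = c at *
  generalize M 1 1 = d at *
  by_cases hbc : b * c = 0
  · left
    have ha : a = 1 := by grind
    have hd : d = 1 := by grind
    have hb : b = 0 := by grind
    have hc : c = 0 := by grind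
    simp [ha, hb, hc, hd]
  · right
    have hb : b ≠ 0 := left_ne_zero_of_mul hbc
    have hd : d = -a := by grind
    have ha : a = 0 := by grind
    refine ⟨b, hb, ?_⟩
    have hc : c = 1 / b := by grind
    simp [ha, hd, hc]

theorem locMat_one {R : Type*} [CommRing R] (n i : ℕ) : locMat n i (1 : Matrix _ _ R) = 1 := by
  ext a b
  simp only [locMat, Matrix.of_apply, Matrix.one_apply, Fin.ext_iff]
  grind

theorem locMat_map {R S : Type*} [CommRing R] [CommRing S] (f : R →+* S) (n i : ℕ)
    (M : Matrix (Fin 2) (Fin 2) R) : (locMat n i M).map f = locMat n i (M.map f) := by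
  ext a b
  simp only [locMat, Matrix.of_apply, Matrix.map_apply]
  split_ifs <;> simp

theorem ell_mul_self {n : ℕ} (i : Fin (n - 1)) : ell i * ell i = 1 :=
  PresentedGroup.one_of_mem (rels := tripletRels n) (Or.inl ⟨i, rfl⟩)

theorem ell_braid {n : ℕ} (i j : Fin (n - 1)) (h : (i : ℕ) + 1 = j) :
    ell i * (ell j * ell i) = ell j * (ell i * ell j) := by
  have := PresentedGroup.one_of_mem (rels := tripletRels n) (Or.inr ⟨i, j, h, rfl⟩)
  rw [map_mul, map_inv, mul_inv_eq_one] at this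
  simp only [map_mul, mul_assoc] at this
  exact this

/-- Fix `n >= 3` and let `lam : L_n → GL_n(ℂ)` be a non-trivial
complex homogeneous 2-local representation. Then there is a nonzero `b : ℂ` with
`lam (l_i) = diag(I_(i-1), [[0,b],[1/b,0]], I_(n-i-1))` for all `i`; equivalently,
`lam (l_i)` is the image of `mu' (l_i)` (with `k = 1`) under the entrywise application
of the ring homomorphism `Z[t,t^-1] → ℂ` sending `t` to `b`. Hence `lam` is the
complex specialization of `mu'` at `t = b`. -/
theorem homogeneous_two_local_is_specialization (n : ℕ) (hn : 3 ≤ n)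
    (lam : TripletGroup n →* Matrix.GeneralLinearGroup (Fin n) ℂ)
    (M : Matrix (Fin 2) (Fin 2) ℂ)
    (hloc : ∀ i : Fin (n - 1), Units.val (lam (ell i)) = locMat n (i : ℕ) M)
    (hnt : ∃ i : Fin (n - 1), lam (ell i) ≠ 1) :
    ∃ b : ℂ, b ≠ 0 ∧
      (∀ i : Fin (n - 1),
        Units.val (lam (ell i)) = locMat n (i : ℕ) !![0, b; 1 / b, 0]) ∧
      ∃ φ : LaurentPolynomial ℤ →+* ℂ, φ (LaurentPolynomial.T 1) = b ∧
        ∀ i : Fin (n - 1), Units.val (lam (ell i)) = (PMat n 1 (i : ℕ)).map φ := by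
  obtain ⟨m, rfl⟩ : ∃ m, n = m + 3 := ⟨n - 3, by omega⟩
  have hM : M = 1 ∨ ∃ b : ℂ, b ≠ 0 ∧ M = !![0, b; 1 / b, 0] := by
    let i₀ : Fin (m + 3 - 1) := ⟨0, by omega⟩
    let i₁ : Fin (m + 3 - 1) := ⟨1, by omega⟩
    have hsq := congrArg (fun g => Units.val (lam g)) (ell_mul_self i₀)
    have hbraid := congrArg (fun g => Units.val (lam g)) (ell_braid i₀ i₁ rfl)
    simp only [map_mul, map_one, Units.val_mul, Units.val_one, hloc] at hsq hbraid
    exact eq_one_or_antidiagonal m M hsq hbraid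
  obtain rfl | ⟨b, hb, rfl⟩ := hM
  · obtain ⟨i, hi⟩ := hnt
    exact absurd (Units.ext ((hloc i).trans (locMat_one _ _))) hi
  · refine ⟨b, hb, hloc, LaurentPolynomial.eval₂ (Int.castRingHom ℂ) (Units.mk0 b hb),
      by simp, fun i => ?_⟩
    rw [hloc, PMat, locMat_map]
    congr 1
    ext x y
    fin_cases x <;> fin_cases y <;> simp
end

section
/- Let a,b,c,d,e,f,g,h ∈ ℂ and set L₁ = [[a,b,0],[c,d,0],[0,0,1]] and L₂ = [[1,0,0],[0,e,f],[0,g,h]], with ad - bc ≠ 0 and eh - fg ≠ 0. Suppose L₁² = L₂² = I₃ and L₁L₂L₁ = L₂L₁L₂, and that not both L₁ and L₂ equal I₃. Then (L₁, L₂) belongs to exactly one of the following four families: (1) b ≠ 0, f ≠ 0, e ≠ 1, a = e/(1-e), d = e/(e-1), c = (1-2e)/(b(e-1)²), g = (1-e²)/f, h = -e; (2) b ≠ 0, a = -1/2, d = 1/2, c = 3/(4b), e = -1, f = 0, h = 1, with g ∈ ℂ arbitrary; (3) f ≠ 0, a = 1, b = 0, d = -1, e = 1/2, g = 3/(4f),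 h = -1/2, with c ∈ ℂ arbitrary; (4) a = 1, b = c = 0, d = -1, e = -1, f = g = 0, h = 1. -/
/-- Classification of the non-trivial 2-local representations of the
triplet group `L_3`: with `L_1 = [[a,b,0],[c,d,0],[0,0,1]]` and
`L_2 = [[1,0,0],[0,e,f],[0,g,h]]` invertible, satisfying `L_1^2 = L_2^2 = 1` and the
braid relation, and not both equal to the identity, the tuple `(L_1, L_2)` belongs to
exactly one of the four listed families. -/
theorem two_local_rep_L3_classification (a b c d e f g h : ℂ)
    (hdet1 : a * d - b * c ≠ 0) (hdet2 : e * h - f * g ≠ 0)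
    (L1 L2 : Matrix (Fin 3) (Fin 3) ℂ)
    (hL1 : L1 = !![a, b, 0; c, d, 0; 0, 0, 1])
    (hL2 : L2 = !![1, 0, 0; 0, e, f; 0, g, h])
    (h1 : L1 * L1 = 1) (h2 : L2 * L2 = 1)
    (h3 : L1 * L2 * L1 = L2 * L1 * L2)
    (hnt : ¬ (L1 = 1 ∧ L2 = 1)) :
    let P1 : Prop := b ≠ 0 ∧ f ≠ 0 ∧ e ≠ 1 ∧
      a = e / (1 - e) ∧ d = e / (e - 1) ∧ c = (1 - 2 * e) / (b * (e - 1) ^ 2) ∧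
      g = (1 - e ^ 2) / f ∧ h = -e
    let P2 : Prop := b ≠ 0 ∧ a = -(1 / 2) ∧ d = 1 / 2 ∧ c = 3 / (4 * b) ∧
      e = -1 ∧ f = 0 ∧ h = 1
    let P3 : Prop := f ≠ 0 ∧ a = 1 ∧ b = 0 ∧ d = -1 ∧ e = 1 / 2 ∧
      g = 3 / (4 * f) ∧ h = -(1 / 2)
    let P4 : Prop := a = 1 ∧ b = 0 ∧ c = 0 ∧ d = -1 ∧ e = -1 ∧ f = 0 ∧
      g = 0 ∧ h = 1
    (P1 ∨ P2 ∨ P3 ∨ P4) ∧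
      ¬ (P1 ∧ P2) ∧ ¬ (P1 ∧ P3) ∧ ¬ (P1 ∧ P4) ∧
      ¬ (P2 ∧ P3) ∧ ¬ (P2 ∧ P4) ∧ ¬ (P3 ∧ P4) := by
  intro P1 P2 P3 P4
  refine ⟨?_, fun ⟨p, q⟩ => p.2.1 q.2.2.2.2.2.1, fun ⟨p, q⟩ => p.1 q.2.2.1,
    fun ⟨p, q⟩ => p.1 q.2.1, fun ⟨p, q⟩ => p.1 q.2.2.1, fun ⟨p, q⟩ => p.1 q.2.1,
    fun ⟨p, q⟩ => p.1 q.2.2.2.2.2.1⟩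
  subst hL1 hL2
  simp only [← Matrix.ext_iff, Fin.forall_fin_succ, Matrix.mul_apply, Fin.sum_univ_three,
    Matrix.one_apply] at h1 h2 h3 hnt
  simp at h1 h2 h3 hnt
  obtain ⟨⟨A1, A2⟩, A3, A4⟩ := h1
  obtain ⟨⟨B1, B2⟩, B3, B4⟩ := h2
  obtain ⟨⟨C1, C2⟩, ⟨C3, C4, C5⟩, C6, C7⟩ := h3
  by_cases hb : b = 0
  · subst hb
    have ha0 : a ≠ 0 := by
      rintro rfl
      simp at hdet1
    have ha : a = 1 := mul_left_cancel₀ ha0 (by linear_combination C1)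
    subst ha
    have hd : (d - 1) * (d + 1) = 0 := by linear_combination A4
    rcases mul_eq_zero.1 hd with hd | hd
    · obtain rfl : d = 1 := by linear_combination hd
      have hc : c = 0 := by linear_combination A3 / 2
      have hf : f = 0 := by linear_combination C5 + B2
      have hg : g = 0 := by linear_combination C6 + B3
      subst hf hg
      have he : e = 1 := by linear_combination C4 + B1
      have hh : h = 1 := by linear_combination C7 + B4
      exact absurd hh (hnt rfl rfl hc rfl he rfl rfl)
    · obtain rfl : d = -1 := by linear_combination hd
      have he : (2 * e - 1) * (e + 1) = 0 := by linear_combination C4 + B1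
      rcases mul_eq_zero.1 he with he | he
      · obtain rfl : e = 1 / 2 := by linear_combination he / 2
        have hf : f ≠ 0 := by
          rintro rfl
          norm_num at B1
        refine Or.inr (Or.inr (Or.inl ⟨hf, rfl, rfl, rfl, rfl, ?_, ?_⟩))
        · field_simp
          linear_combination 4 * B1
        · exact mul_left_cancel₀ hf (by linear_combination B2)
      · obtain rfl : e = -1 := by linear_combination he
        have hc : c = 0 := by linear_combination C3 / 3 - A3 / 3
        have hf : f = 0 := by linear_combination -(B2 + C5) / 3
        have hg : g = 0 := by linear_combination -(B3 + C6) / 3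
        subst hf hg
        exact Or.inr (Or.inr (Or.inr ⟨rfl, rfl, hc, rfl, rfl, rfl, rfl,
          by linear_combination C7 + B4⟩))
  · have hd : d = -a := mul_left_cancel₀ hb (by linear_combination A2)
    subst hd
    have hae : a * (1 - e) = e := mul_left_cancel₀ hb (by linear_combination C2)
    have he : 1 - e ≠ 0 := by
      intro h0
      rw [h0, mul_zero] at hae
      simp [← hae] at h0
    have he' : e - 1 ≠ 0 := fun h0 => he (by linear_combination -h0)
    by_cases hf : f = 0
    · subst hf
      have he1 : e = -1 := mul_left_cancel₀ he' (by linear_combination B1)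
      subst he1
      obtain rfl : a = -(1 / 2) := by linear_combination hae / 2
      refine Or.inr (Or.inl ⟨hb, rfl, by norm_num, ?_, rfl, rfl, by linear_combination C7 + B4⟩)
      field_simp
      linear_combination 4 * A1
    · refine Or.inl ⟨hb, hf, sub_ne_zero.1 he', ?_, ?_, ?_, ?_, ?_⟩
      · rw [eq_div_iff he, hae]
      · rw [eq_div_iff he']
        linear_combination hae
      · rw [eq_div_iff (mul_ne_zero hb (pow_ne_zero 2 he'))]
        linear_combination (e - 1) ^ 2 * A1 - (a * (1 - e) + e) * hae
      · rw [eq_div_iff hf]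
        linear_combination B1
      · exact mul_left_cancel₀ hf (by linear_combination B2)
end

section
/- Let b, x ∈ ℂ* and let ω₁ : VL₂ → GL₂(ℂ) be the homomorphism from the group VL₂ = ⟨ℓ₁, ρ₁ | ℓ₁² = ρ₁² = 1⟩ determined by ω₁(ℓ₁) = [[0,b],[1/b,0]] and ω₁(ρ₁) = [[0,x],[1/x,0]]. Then ω₁ is not injective if and only if there exists a positive integer m such that (b/x)^m = 1, i.e. if and only if b/x is a root of unity. -/
/-- The defining relations of the virtual triplet group `VL_2`: two generators
`l_1 = true` and `rho_1 = false`, with relations `l_1 ^ 2 = 1` and `rho_1 ^ 2 = 1`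
(the free product of two cyclic groups of order 2). -/
def vtripletRels2 : Set (FreeGroup Bool) :=
  {r | r = FreeGroup.of true * FreeGroup.of true ∨
       r = FreeGroup.of false * FreeGroup.of false}

/-- The virtual triplet group `VL_2`. -/
abbrev VTripletGroup2 := PresentedGroup vtripletRels2

/-- The generator `l_1` of `VL_2`. -/
def ell2 : VTripletGroup2 := PresentedGroup.of true

/-- The generator `rho_1` of `VL_2`. -/
def rho2 : VTripletGroup2 := PresentedGroup.of false

theorem ell2_mul_self : ell2 * ell2 = 1 :=
  PresentedGroup.one_of_mem (rels := vtripletRels2) (Or.inl rfl)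

theorem rho2_mul_self : rho2 * rho2 = 1 :=
  PresentedGroup.one_of_mem (rels := vtripletRels2) (Or.inr rfl)

/-- Conjugation by a reflection inverts the rotation `l_1 rho_1`. -/
theorem ell2_mul_zpow (k : ℤ) :
    ell2 * (ell2 * rho2) ^ k = (ell2 * rho2) ^ (-k) * ell2 := by
  have hl : ell2⁻¹ = ell2 := inv_eq_of_mul_eq_one_left ell2_mul_self
  have hr : rho2⁻¹ = rho2 := inv_eq_of_mul_eq_one_left rho2_mul_self
  have h : SemiconjBy ell2 (ell2 * rho2) (ell2 * rho2)⁻¹ := by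
    rw [SemiconjBy, mul_inv_rev, hl, hr, ← mul_assoc, ell2_mul_self, one_mul, mul_assoc,
      ell2_mul_self, mul_one]
  rw [zpow_neg, ← inv_zpow]
  exact (h.zpow_right k).eq

/-- Every element of `VL_2` is a power of `l_1 rho_1`, or such a power times `l_1`. -/
theorem VTripletGroup2.exists_zpow (g : VTripletGroup2) :
    ∃ k : ℤ, g = (ell2 * rho2) ^ k ∨ g = (ell2 * rho2) ^ k * ell2 := by
  have hl (g : VTripletGroup2)
      (h : ∃ k : ℤ, g = (ell2 * rho2) ^ k ∨ g = (ell2 * rho2) ^ k * ell2) :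
      ∃ k : ℤ, ell2 * g = (ell2 * rho2) ^ k ∨ ell2 * g = (ell2 * rho2) ^ k * ell2 := by
    obtain ⟨k, rfl | rfl⟩ := h
    · exact ⟨-k, Or.inr (ell2_mul_zpow k)⟩
    · exact ⟨-k, Or.inl (by rw [← mul_assoc, ell2_mul_zpow, mul_assoc, ell2_mul_self, mul_one])⟩
  have hr (g : VTripletGroup2)
      (h : ∃ k : ℤ, g = (ell2 * rho2) ^ k ∨ g = (ell2 * rho2) ^ k * ell2) :
      ∃ k : ℤ, rho2 * g = (ell2 * rho2) ^ k ∨ rho2 * g = (ell2 * rho2) ^ k * ell2 := by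
    have hρ : rho2 * g = ell2 * (ell2 * rho2 * g) := by
      rw [← mul_assoc, ← mul_assoc, ell2_mul_self, one_mul]
    rw [hρ]
    apply hl
    obtain ⟨k, rfl | rfl⟩ := h
    · exact ⟨1 + k, Or.inl (zpow_one_add _ k).symm⟩
    · exact ⟨1 + k, Or.inr (by rw [zpow_one_add, mul_assoc (ell2 * rho2)])⟩
  have hgen (i : Bool) (g : VTripletGroup2)
      (h : ∃ k : ℤ, g = (ell2 * rho2) ^ k ∨ g = (ell2 * rho2) ^ k * ell2) :
      ∃ k : ℤ, PresentedGroup.of i * g = (ell2 * rho2) ^ k ∨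
        PresentedGroup.of i * g = (ell2 * rho2) ^ k * ell2 := by
    cases i
    · exact hr g h
    · exact hl g h
  have hinv (i : Bool) : (PresentedGroup.of i : VTripletGroup2)⁻¹ = PresentedGroup.of i := by
    cases i
    · exact inv_eq_of_mul_eq_one_left rho2_mul_self
    · exact inv_eq_of_mul_eq_one_left ell2_mul_self
  have hg : g ∈ Subgroup.closure (Set.range (PresentedGroup.of (rels := vtripletRels2))) := by
    rw [PresentedGroup.closure_range_of]
    trivial
  induction hg using Subgroup.closure_induction_left with
  | one => exact ⟨0, Or.inl (zpow_zero _).symm⟩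
  | mul_left a ha y _ ih =>
    obtain ⟨i, rfl⟩ := ha
    exact hgen i y ih
  | inv_mul_cancel a ha y _ ih =>
    obtain ⟨i, rfl⟩ := ha
    rw [hinv]
    exact hgen i y ih

/-- The homomorphism from `VL_2` to the infinite dihedral group. -/
def VTripletGroup2.toDihedral : VTripletGroup2 →* DihedralGroup 0 :=
  PresentedGroup.toGroup (f := fun i => cond i (DihedralGroup.sr 0) (DihedralGroup.sr 1)) (by
    rintro r (rfl | rfl) <;> simp)

theorem ell2_mul_rho2_pow_ne_one {m : ℕ} (hm : 0 < m) : (ell2 * rho2) ^ m ≠ 1 := by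
  intro h
  have hc : VTripletGroup2.toDihedral (ell2 * rho2) = DihedralGroup.r 1 := by
    simp [VTripletGroup2.toDihedral, ell2, rho2]
  have h' := congrArg VTripletGroup2.toDihedral h
  rw [map_pow, hc, map_one] at h'
  have := orderOf_dvd_of_pow_eq_one h'
  rw [DihedralGroup.orderOf_r_one, zero_dvd_iff] at this
  omega

/-- Let `b, x` be nonzero complex numbers and let
`omega_1 : VL_2 → GL_2(ℂ)` be the homomorphism with
`omega_1 (l_1) = [[0,b],[1/b,0]]` and `omega_1 (rho_1) = [[0,x],[1/x,0]]`. Then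
`omega_1` is not injective if and only if `b / x` is an `m`-th root of unity for some
positive integer `m`. -/
theorem omega1_VL2_faithfulness (b x : ℂ) (hb : b ≠ 0) (hx : x ≠ 0)
    (ω : VTripletGroup2 →* Matrix.GeneralLinearGroup (Fin 2) ℂ)
    (h1 : Units.val (ω ell2) = !![0, b; 1 / b, 0])
    (h2 : Units.val (ω rho2) = !![0, x; 1 / x, 0]) :
    ¬ Function.Injective ω ↔ ∃ m : ℕ, 0 < m ∧ (b / x) ^ m = 1 := by
  have hc : Units.val (ω (ell2 * rho2)) = Matrix.diagonal ![b / x, x / b] := by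
    rw [map_mul, Units.val_mul, h1, h2]
    ext i j
    fin_cases i <;> fin_cases j <;> simp [Matrix.mul_apply, div_eq_mul_inv, mul_comm]
  have hpow (m : ℕ) : ω (ell2 * rho2) ^ m = 1 ↔ (b / x) ^ m = 1 := by
    rw [Units.ext_iff, Units.val_pow_eq_pow_val, hc, Matrix.diagonal_pow, Units.val_one,
      ← Matrix.diagonal_one, Matrix.diagonal_eq_diagonal_iff]
    simp only [Fin.forall_fin_two, Pi.pow_apply, Matrix.cons_val_zero, Matrix.cons_val_one]
    refine ⟨fun h => h.1, fun h => ⟨h, ?_⟩⟩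
    rw [← inv_div, inv_pow, h, inv_one]
  constructor
  · intro h
    rw [injective_iff_map_eq_one] at h
    push Not at h
    obtain ⟨g, hg, hne⟩ := h
    obtain ⟨k, rfl | rfl⟩ := g.exists_zpow
    · have hk : k ≠ 0 := by
        rintro rfl
        exact hne (zpow_zero _)
      refine ⟨k.natAbs, Int.natAbs_pos.mpr hk, (hpow _).mp ?_⟩
      rwa [pow_natAbs_eq_one, ← map_zpow]
    · refine ⟨2, two_pos, (hpow _).mp ?_⟩
      have hl : ω ell2 = ω (ell2 * rho2) ^ (-k) := by
        rw [map_mul, map_zpow] at hg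
        rw [zpow_neg]
        exact (inv_eq_of_mul_eq_one_right hg).symm
      have h := congrArg ω (ell2_mul_zpow 1)
      rw [map_mul, map_mul, map_zpow, map_zpow, hl, (Commute.zpow_zpow_self _ _ _).eq,
        mul_left_inj, zpow_one, zpow_neg_one] at h
      rw [pow_two]
      exact mul_eq_one_iff_eq_inv.mpr h
  · rintro ⟨m, hm, h⟩ hinj
    apply ell2_mul_rho2_pow_ne_one hm
    apply hinj
    rw [map_pow, map_one]
    exact (hpow m).mpr h
end

section
/- Fix n ≥ 3 and b, x ∈ ℂ*. Let ω₁ : VL_n → GL_n(ℂ) be the homomorphism determined by ω₁(ℓ_i) = diag(I_{i-1}, [[0,b],[1/b,0]], I_{n-i-1}) and ω₁(ρ_i) = diag(I_{i-1}, [[0,x],[1/x,0]], I_{n-i-1}) for 1 ≤ i ≤ n-1. Then ω₁ is not injective. -/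
/-- The defining relations of the virtual triplet group `VL_n`: generators
`l_i = Sum.inl i` and `rho_i = Sum.inr i` for `i : Fin (n-1)` (0-based), with the
triplet relations on the `l_i`, together with `rho_i ^ 2 = 1`,
`rho_i rho_j = rho_j rho_i` for `|i-j| >= 2`,
`rho_i rho_{i+1} rho_i = rho_{i+1} rho_i rho_{i+1}`, `l_i rho_j = rho_j l_i` for
`|i-j| >= 2`, and `rho_i rho_{i+1} l_i = l_{i+1} rho_i rho_{i+1}`. -/
def vtripletRels (n : ℕ) : Set (FreeGroup (Fin (n - 1) ⊕ Fin (n - 1))) :=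
  {r | (∃ i : Fin (n - 1), r = FreeGroup.of (.inl i) * FreeGroup.of (.inl i)) ∨
    (∃ i j : Fin (n - 1), (i : ℕ) + 1 = (j : ℕ) ∧
      r = FreeGroup.of (.inl i) * FreeGroup.of (.inl j) * FreeGroup.of (.inl i) *
          (FreeGroup.of (.inl j) * FreeGroup.of (.inl i) * FreeGroup.of (.inl j))⁻¹) ∨
    (∃ i : Fin (n - 1), r = FreeGroup.of (.inr i) * FreeGroup.of (.inr i)) ∨
    (∃ i j : Fin (n - 1), ((i : ℕ) + 2 ≤ (j : ℕ) ∨ (j : ℕ) + 2 ≤ (i : ℕ)) ∧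
      r = FreeGroup.of (.inr i) * FreeGroup.of (.inr j) *
          (FreeGroup.of (.inr j) * FreeGroup.of (.inr i))⁻¹) ∨
    (∃ i j : Fin (n - 1), (i : ℕ) + 1 = (j : ℕ) ∧
      r = FreeGroup.of (.inr i) * FreeGroup.of (.inr j) * FreeGroup.of (.inr i) *
          (FreeGroup.of (.inr j) * FreeGroup.of (.inr i) * FreeGroup.of (.inr j))⁻¹) ∨
    (∃ i j : Fin (n - 1), ((i : ℕ) + 2 ≤ (j : ℕ) ∨ (j : ℕ) + 2 ≤ (i : ℕ)) ∧
      r = FreeGroup.of (.inl i) * FreeGroup.of (.inr j) *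
          (FreeGroup.of (.inr j) * FreeGroup.of (.inl i))⁻¹) ∨
    (∃ i j : Fin (n - 1), (i : ℕ) + 1 = (j : ℕ) ∧
      r = FreeGroup.of (.inr i) * FreeGroup.of (.inr j) * FreeGroup.of (.inl i) *
          (FreeGroup.of (.inl j) * FreeGroup.of (.inr i) * FreeGroup.of (.inr j))⁻¹)}

/-- The virtual triplet group `VL_n`. -/
abbrev VTripletGroup (n : ℕ) := PresentedGroup (vtripletRels n)

/-- The generator `l_{i+1}` of `VL_n`. -/
def ellV {n : ℕ} (i : Fin (n - 1)) : VTripletGroup n := PresentedGroup.of (Sum.inl i)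

/-- The generator `rho_{i+1}` of `VL_n`. -/
def rhoV {n : ℕ} (i : Fin (n - 1)) : VTripletGroup n := PresentedGroup.of (Sum.inr i)

/-- The defining relations of the welded triplet group `WL_n`: those of `VL_n` together
with the welded relations `rho_i l_{i+1} l_i = l_{i+1} l_i rho_{i+1}`. -/
def wtripletRels (n : ℕ) : Set (FreeGroup (Fin (n - 1) ⊕ Fin (n - 1))) :=
  vtripletRels n ∪
    {r | ∃ i j : Fin (n - 1), (i : ℕ) + 1 = (j : ℕ) ∧
      r = FreeGroup.of (.inr i) * FreeGroup.of (.inl j) * FreeGroup.of (.inl i) *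
          (FreeGroup.of (.inl j) * FreeGroup.of (.inl i) * FreeGroup.of (.inr j))⁻¹}

/-- The welded triplet group `WL_n`. -/
abbrev WTripletGroup (n : ℕ) := PresentedGroup (wtripletRels n)

/-- The generator `l_{i+1}` of `WL_n`. -/
def ellW {n : ℕ} (i : Fin (n - 1)) : WTripletGroup n := PresentedGroup.of (Sum.inl i)

/-- The generator `rho_{i+1}` of `WL_n`. -/
def rhoW {n : ℕ} (i : Fin (n - 1)) : WTripletGroup n := PresentedGroup.of (Sum.inr i)

/-- The monomial matrix `locMat n i !![0, c; 1 / c, 0]` exchanges the coordinates `i` and `i + 1`,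
scaling them by `c` and `1 / c`. -/
theorem locMat_antidiag_mulVec {K : Type*} [Field K] {n i : ℕ} (hi : i + 1 < n) (c : K)
    (v : Fin n → K) (a : Fin n) :
    (locMat n i !![0, c; 1 / c, 0]).mulVec v a =
      if (a : ℕ) = i then c * v ⟨i + 1, hi⟩
      else if (a : ℕ) = i + 1 then 1 / c * v ⟨i, by omega⟩
      else v a := by
  rw [Matrix.mulVec, dotProduct]
  split_ifs with h₀ h₁
  · rw [Finset.sum_eq_single ⟨i + 1, hi⟩]
    · simp [locMat, h₀]
    · intro k _ hk
      have hk' : (k : ℕ) ≠ i + 1 := fun h => hk (Fin.ext h)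
      simp +contextual [locMat, h₀, hk', eq_comm (b := (k : ℕ))]
    · simp
  · rw [Finset.sum_eq_single ⟨i, by omega⟩]
    · simp [locMat, h₁]
    · intro k _ hk
      have hk' : (k : ℕ) ≠ i := fun h => hk (Fin.ext h)
      simp +contextual [locMat, h₁, hk', eq_comm (b := (k : ℕ))]
    · simp
  · rw [Finset.sum_eq_single a]
    · simp [locMat, h₀, h₁]
    · intro k _ hk
      have hk' : (a : ℕ) ≠ k := fun h => hk (Fin.ext h.symm)
      simp [locMat, h₀, h₁, hk']
    · simp

/-- The images of `l_1 rho_1 l_2` and `rho_2 l_1 rho_1` under `omega_1` coincide. -/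
theorem locMat_antidiag_mul_relation {K : Type*} [Field K] {n : ℕ} (hn : 3 ≤ n) {b x : K}
    (hb : b ≠ 0) (hx : x ≠ 0) :
    locMat n 0 !![0, b; 1 / b, 0] * locMat n 0 !![0, x; 1 / x, 0] *
        locMat n 1 !![0, b; 1 / b, 0] =
      locMat n 1 !![0, x; 1 / x, 0] * locMat n 0 !![0, b; 1 / b, 0] *
        locMat n 0 !![0, x; 1 / x, 0] := by
  refine Matrix.mulVec_injective (funext fun v => ?_)
  have h₁ : 0 + 1 < n := by omega
  have h₂ : 1 + 1 < n := by omega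
  simp only [← Matrix.mulVec_mulVec]
  funext a
  simp only [locMat_antidiag_mulVec h₁, locMat_antidiag_mulVec h₂]
  by_cases a₀ : (a : ℕ) = 0
  · simp [a₀]
  by_cases a₁ : (a : ℕ) = 1
  · simp [a₁]
    field_simp
  by_cases a₂ : (a : ℕ) = 2
  · simp [a₂]
    field_simp
  · simp [a₀, a₁, a₂]

/-- The homomorphism `VL_n → {±1}` giving the parity of the number of letters `l_i` in a word. -/
def ellParity (n : ℕ) : VTripletGroup n →* ℤˣ :=
  PresentedGroup.toGroup (f := Sum.elim (fun _ => -1) fun _ => 1) (by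
    rintro r (⟨i, rfl⟩ | ⟨i, j, _, rfl⟩ | ⟨i, rfl⟩ | ⟨i, j, _, rfl⟩ | ⟨i, j, _, rfl⟩ |
      ⟨i, j, _, rfl⟩ | ⟨i, j, _, rfl⟩) <;> simp)

@[simp]
theorem ellParity_ellV {n : ℕ} (i : Fin (n - 1)) : ellParity n (ellV i) = -1 := by
  simp [ellParity, ellV]

@[simp]
theorem ellParity_rhoV {n : ℕ} (i : Fin (n - 1)) : ellParity n (rhoV i) = 1 := by
  simp [ellParity, rhoV]

/-- Fix `n >= 3` and nonzero `b, x : ℂ`. The homomorphism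
`omega_1 : VL_n → GL_n(ℂ)` determined by
`omega_1 (l_i) = diag(I_(i-1), [[0,b],[1/b,0]], I_(n-i-1))` and
`omega_1 (rho_i) = diag(I_(i-1), [[0,x],[1/x,0]], I_(n-i-1))` is not injective. -/
theorem omega1_not_faithful (n : ℕ) (hn : 3 ≤ n) (b x : ℂ)
    (hb : b ≠ 0) (hx : x ≠ 0)
    (ω : VTripletGroup n →* Matrix.GeneralLinearGroup (Fin n) ℂ)
    (hℓ : ∀ i : Fin (n - 1),
      Units.val (ω (ellV i)) = locMat n (i : ℕ) !![0, b; 1 / b, 0])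
    (hρ : ∀ i : Fin (n - 1),
      Units.val (ω (rhoV i)) = locMat n (i : ℕ) !![0, x; 1 / x, 0]) :
    ¬ Function.Injective ω := by
  intro hω
  let i : Fin (n - 1) := ⟨0, by omega⟩
  let j : Fin (n - 1) := ⟨1, by omega⟩
  have h : ellV i * rhoV i * ellV j = rhoV j * ellV i * rhoV i := by
    refine hω (Units.ext ?_)
    simpa only [map_mul, Units.val_mul, hℓ, hρ] using locMat_antidiag_mul_relation hn hb hx
  have hparity := congrArg (ellParity n) h
  simp only [map_mul, ellParity_ellV, ellParity_rhoV] at hparity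
  exact absurd hparity (by decide)
end
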